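/- Let (X, B, ν) be a probability space and T : X → X an ergodic measure-preserving transformation. Let (f_m) be a sequence of measurable nonnegative real-valued functions on X such that f_m → f pointwise ν-a.e. and ∫ f dν = +∞. Then for ν-a.e. x, (1/N) · Σ_{n=0}^{N-1} f_{N-n}(T^n x) → +∞ as N → ∞. -/

import Mathlib

open MeasureTheory Filter

/-- The running maximum `max_{0 ≤ k ≤ n} ∑_{j < k} h (T^j x)` of the Birkhoff sums of `h`,
defined recursively. -/
noncomputable def birkhoffMax {X : Type*} (T : X → X) (h : X → ℝ) : ℕ → X → ℝ
  | 0, _ => 0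
  | n + 1, x => max 0 (h x + birkhoffMax T h n (T x))

section birkhoffMax

variable {X : Type*} {T : X → X} {h : X → ℝ}

lemma birkhoffMax_nonneg (n : ℕ) (x : X) : 0 ≤ birkhoffMax T h n x := by
  cases n with
  | zero => exact le_rfl
  | succ n => exact le_max_left _ _

lemma birkhoffMax_le_succ (n : ℕ) (x : X) :
    birkhoffMax T h n x ≤ birkhoffMax T h (n + 1) x := by
  induction n generalizing x with
  | zero => exact le_max_left _ _
  | succ n ih => exact max_le_max le_rfl (by linarith [ih (T x)])

lemma birkhoffMax_monotone (x : X) : Monotone fun n => birkhoffMax T h n x :=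
  monotone_nat_of_le_succ fun n => birkhoffMax_le_succ n x

lemma sum_le_birkhoffMax (n : ℕ) (x : X) :
    ∑ j ∈ Finset.range n, h (T^[j] x) ≤ birkhoffMax T h n x := by
  induction n generalizing x with
  | zero => simp [birkhoffMax]
  | succ n ih =>
    rw [Finset.sum_range_succ']
    refine le_trans ?_ (le_max_right _ _)
    have := ih (T x)
    simp only [Function.iterate_succ_apply, Function.iterate_zero, id_eq] at *
    linarith

lemma birkhoffMax_succ_sub (n : ℕ) (x : X) :
    birkhoffMax T h (n + 1) x - birkhoffMax T h n (T x) =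
      max (-birkhoffMax T h n (T x)) (h x) := by
  rw [birkhoffMax, ← max_sub_sub_right, zero_sub, add_sub_cancel_right]

variable [MeasurableSpace X] {ν : Measure X}

lemma measurable_birkhoffMax (hT : Measurable T) (hh : Measurable h) (n : ℕ) :
    Measurable (birkhoffMax T h n) := by
  induction n with
  | zero => exact measurable_const
  | succ n ih => exact measurable_const.max (hh.add (ih.comp hT))

lemma integrable_birkhoffMax (hT : MeasurePreserving T ν ν) (hint : Integrable h ν) (n : ℕ) :
    Integrable (birkhoffMax T h n) ν := by
  induction n with
  | zero => exact integrable_zero _ _ _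
  | succ n ih =>
    exact (integrable_zero _ _ _).sup (hint.add (hT.integrable_comp_of_integrable ih))

/-- If `∫ h < 0` and `T` is ergodic, then the Birkhoff sums of `h` are a.e. bounded above. -/
lemma Ergodic.ae_exists_sum_le_of_integral_neg (hT : Ergodic T ν)
    (hh : Measurable h) (hint : Integrable h ν) (hneg : ∫ x, h x ∂ν < 0) :
    ∀ᵐ x ∂ν, ∃ B : ℝ, ∀ n, ∑ j ∈ Finset.range n, h (T^[j] x) ≤ B := by
  have hmp := hT.toMeasurePreserving
  set A : Set X := {x | ∃ K : ℕ, ∀ n, birkhoffMax T h n x ≤ K} with hA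
  have hAmeas : MeasurableSet A := by
    have : A = ⋃ K : ℕ, ⋂ n, {x | birkhoffMax T h n x ≤ K} := by ext; simp [hA]
    rw [this]
    exact .iUnion fun K => .iInter fun n =>
      measurableSet_le (measurable_birkhoffMax hmp.measurable hh n) measurable_const
  have hAinv : T ⁻¹' A = A := by
    ext x
    constructor
    · rintro ⟨K, hK⟩
      obtain ⟨L, hL⟩ := exists_nat_ge (max 0 (h x + K))
      refine ⟨L, fun n => (birkhoffMax_le_succ n x).trans (le_trans ?_ hL)⟩
      exact max_le_max le_rfl (by linarith [hK n])
    · rintro ⟨K, hK⟩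
      obtain ⟨L, hL⟩ := exists_nat_ge (K - h x)
      refine ⟨L, fun n => ?_⟩
      have h1 := hK (n + 1)
      have h2 : h x + birkhoffMax T h n (T x) ≤ birkhoffMax T h (n + 1) x := le_max_right _ _
      linarith
  rcases hT.toPreErgodic.ae_mem_or_ae_notMem hAmeas hAinv with hmem | hnot
  · filter_upwards [hmem] with x ⟨K, hK⟩
    exact ⟨K, fun n => (sum_le_birkhoffMax n x).trans (hK n)⟩
  exfalso
  have hlim : Tendsto (fun n => ∫ x, max (-birkhoffMax T h n (T x)) (h x) ∂ν) atTop
      (nhds (∫ x, h x ∂ν)) := by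
    refine tendsto_integral_of_dominated_convergence (fun x => |h x|) (fun n => ?_) hint.abs
      (fun n => ?_) ?_
    · exact (((measurable_birkhoffMax hmp.measurable hh n).comp hmp.measurable).neg.max
        hh).aestronglyMeasurable
    · refine .of_forall fun x => ?_
      rw [Real.norm_eq_abs]
      have h0 := birkhoffMax_nonneg (T := T) (h := h) n (T x)
      refine abs_le.2 ⟨(neg_abs_le _).trans (le_max_right _ _), max_le ?_ (le_abs_self _)⟩
      linarith [abs_nonneg (h x)]
    · filter_upwards [hnot] with x hx
      have hx' : T x ∉ A := fun hmem => hx (hAinv ▸ hmem)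
      obtain ⟨L, hL⟩ := exists_nat_ge (-h x)
      obtain ⟨n₀, hn₀⟩ : ∃ n, (L : ℝ) < birkhoffMax T h n (T x) := by
        by_contra! hcon
        exact hx' ⟨L, hcon⟩
      refine tendsto_const_nhds.congr' ?_
      filter_upwards [eventually_ge_atTop n₀] with n hn
      have := birkhoffMax_monotone (T := T) (h := h) (T x) hn
      exact (max_eq_right (by dsimp only at this; linarith)).symm
  refine absurd (ge_of_tendsto' hlim fun n => ?_) (not_le.2 hneg)
  have hi := integrable_birkhoffMax hmp hint
  simp_rw [← birkhoffMax_succ_sub]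
  have hcomp : ∫ x, birkhoffMax T h n (T x) ∂ν = ∫ x, birkhoffMax T h n x ∂ν := by
    rw [← integral_map hmp.aemeasurable
      (measurable_birkhoffMax hmp.measurable hh n).aestronglyMeasurable, hmp.map_eq]
  have hiT : Integrable (fun x => birkhoffMax T h n (T x)) ν :=
    hmp.integrable_comp_of_integrable (hi n)
  rw [integral_sub (hi (n + 1)) hiT, hcomp, sub_nonneg]
  exact integral_mono (hi n) (hi (n + 1)) (birkhoffMax_le_succ n)

end birkhoffMax

/-- If the a.e. limit of nonnegative functions `f m` has infinite integral, then a tail of the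
sequence is bounded below by a bounded measurable function of arbitrarily large integral. -/
lemma exists_measurable_le_tail_of_lintegral_eq_top {X : Type*} [MeasurableSpace X]
    {ν : Measure X} [IsFiniteMeasure ν] {f : ℕ → X → ℝ} {flim : X → ℝ}
    (hmeas : ∀ m, Measurable (f m)) (hnonneg : ∀ m x, 0 ≤ f m x)
    (hconv : ∀ᵐ x ∂ν, Tendsto (fun m => f m x) atTop (nhds (flim x)))
    (hinf : ∫⁻ x, ENNReal.ofReal (flim x) ∂ν = ⊤) (C : ℝ) :
    ∃ (k : ℕ) (g : X → ℝ), Measurable g ∧ Integrable g ν ∧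
      (∀ m ≥ k, ∀ x, g x ≤ f m x) ∧ C < ∫ x, g x ∂ν := by
  set u : ℕ → X → ENNReal := fun k x => min (k : ENNReal) (⨅ m ≥ k, ENNReal.ofReal (f m x))
    with hu
  have humeas (k : ℕ) : Measurable (u k) :=
    measurable_const.min (.iInf fun m => .iInf fun _ => (hmeas m).ennreal_ofReal)
  have humono (x : X) : Monotone fun k => u k x := fun a b hab =>
    min_le_min (by exact_mod_cast hab) (biInf_mono fun m hm => le_trans hab hm)
  have hlim : Tendsto (fun k => ∫⁻ x, u k x ∂ν) atTop (nhds ⊤) := by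
    rw [← hinf]
    refine lintegral_tendsto_of_tendsto_of_monotone (fun k => (humeas k).aemeasurable)
      (.of_forall humono) ?_
    filter_upwards [hconv] with x hx
    have h1 : Tendsto (fun m => ENNReal.ofReal (f m x)) atTop
        (nhds (ENNReal.ofReal (flim x))) := ENNReal.tendsto_ofReal hx
    have h2 : Tendsto (fun k : ℕ => ⨅ m ≥ k, ENNReal.ofReal (f m x)) atTop
        (nhds (ENNReal.ofReal (flim x))) := by
      rw [← h1.liminf_eq, liminf_eq_iSup_iInf_of_nat]
      exact tendsto_atTop_iSup fun a b hab => biInf_mono fun m hm => le_trans hab hm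
    simpa using ENNReal.tendsto_nat_nhds_top.min h2
  obtain ⟨k, hk⟩ := (hlim.eventually_const_lt (ENNReal.ofReal_lt_top (r := C))).exists
  have hbound (x : X) : u k x ≤ k := min_le_left _ _
  have hfin : ∫⁻ x, u k x ∂ν ≠ ⊤ := by
    refine ((lintegral_mono hbound).trans_lt ?_).ne
    rw [lintegral_const]
    exact ENNReal.mul_lt_top (ENNReal.natCast_lt_top k) (measure_lt_top ν _)
  refine ⟨k, fun x => (u k x).toReal, (humeas k).ennreal_toReal,
    integrable_toReal_of_lintegral_ne_top (humeas k).aemeasurable hfin,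
    fun m hm x => ?_, ?_⟩
  · exact ENNReal.toReal_le_of_le_ofReal (hnonneg m x)
      ((min_le_right _ _).trans (iInf₂_le m hm))
  · rw [integral_toReal (humeas k).aemeasurable
      (.of_forall fun x => (hbound x).trans_lt (ENNReal.natCast_lt_top k))]
    refine lt_of_not_ge fun hle => hk.not_ge ?_
    exact (ENNReal.ofReal_toReal hfin).symm.trans_le (ENNReal.ofReal_le_ofReal hle)

/-- Maker's theorem for positive non-integrable functions: if `f m → f` a.e. pointwise,
each `f m` is measurable and nonnegative, and `∫ f dν = ∞`, then for a.e. `x` the averages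
`(1/N) Σ_{n<N} f_{N-n}(T^n x)` tend to `+∞`. -/
theorem stmt0 {X : Type*} [MeasurableSpace X] (ν : Measure X) [IsProbabilityMeasure ν]
    (T : X → X) (hT : Ergodic T ν)
    (f : ℕ → X → ℝ) (flim : X → ℝ)
    (hmeas : ∀ m, Measurable (f m)) (hnonneg : ∀ m x, 0 ≤ f m x)
    (hconv : ∀ᵐ x ∂ν, Tendsto (fun m => f m x) atTop (nhds (flim x)))
    (hinf : ∫⁻ x, ENNReal.ofReal (flim x) ∂ν = ⊤) :
    ∀ᵐ x ∂ν, Tendsto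
      (fun N : ℕ => (1 / (N : ℝ)) * ∑ n ∈ Finset.range N, f (N - n) (T^[n] x))
      atTop atTop := by
  have key : ∀ C : ℕ, ∀ᵐ x ∂ν, ∀ᶠ N : ℕ in atTop,
      (C : ℝ) ≤ (1 / (N : ℝ)) * ∑ n ∈ Finset.range N, f (N - n) (T^[n] x) := by
    intro C
    obtain ⟨k, g, hg, hgint, hgle, hgC⟩ :=
      exists_measurable_le_tail_of_lintegral_eq_top hmeas hnonneg hconv hinf (C + 1 : ℝ)
    have hneg : ∫ x, ((C + 1 : ℝ) - g x) ∂ν < 0 := by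
      rw [integral_sub (integrable_const _) hgint]
      simpa using hgC
    filter_upwards [hT.ae_exists_sum_le_of_integral_neg (measurable_const.sub hg)
      ((integrable_const _).sub hgint) hneg] with x ⟨B, hB⟩
    obtain ⟨N₀, hN₀⟩ := exists_nat_ge (k * (C + 1 : ℝ) + B)
    filter_upwards [eventually_ge_atTop (max 1 (max k N₀))] with N hN
    simp only [max_le_iff] at hN
    obtain ⟨hN1, hNk, hNN₀⟩ := hN
    have hNpos : (0 : ℝ) < N := by exact_mod_cast hN1
    have hNN₀' : (N₀ : ℝ) ≤ N := by exact_mod_cast hNN₀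
    have hlow : ∑ n ∈ Finset.range (N - k), g (T^[n] x) ≤
        ∑ n ∈ Finset.range N, f (N - n) (T^[n] x) := by
      refine (Finset.sum_le_sum fun n hn => hgle (N - n) ?_ _).trans
        (Finset.sum_le_sum_of_subset_of_nonneg (Finset.range_mono (Nat.sub_le N k))
          fun n _ _ => hnonneg _ _)
      have := Finset.mem_range.1 hn
      omega
    have hsum := hB (N - k)
    simp only [Pi.sub_apply] at hsum
    rw [Finset.sum_sub_distrib, Finset.sum_const, Finset.card_range, nsmul_eq_mul,
      Nat.cast_sub hNk] at hsum
    rw [one_div, inv_mul_eq_div, le_div_iff₀ hNpos]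
    linarith
  filter_upwards [ae_all_iff.2 key] with x hx
  refine tendsto_atTop.2 fun b => ?_
  obtain ⟨C, hC⟩ := exists_nat_ge b
  filter_upwards [hx C] with N hN using hC.trans hN
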